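/- arXiv:1710.02047 — 3 statements merged into one kernel-verified Lean document; each statement's English description precedes it below -/
import Mathlib

section
/- The Niederkrüger map Φ : ℝ × ℝ × E → ℝ × ℝ × E, Φ(a, b, m) = (a − ψ(m), b, m), is a smooth bijection with smooth inverse (c₁, c₂, m) ↦ (c₁ + ψ(m), c₂, m), and it is biholomorphic in the following sense: for every (a, b, m), the differential DΦ(a, b, m), given by (v_a, v_b, v) ↦ (v_a − Dψ(m)(v), v_b, v), satisfies DΦ(a, b, m) ∘ Ĵ(m) = (i ⊕ J_V) ∘ DΦ(a, b, m); moreover Ĵ(m) ∘ Ĵ(m) = −id for every m. -/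
noncomputable section

/-- The model space `E = ℝ^d × ℝ^d × ℝ² × ℝ^{n−1−d} × ℝ^{n−1−d}`,
with components `(q, p, (x₀, y₀), x, y)`. -/
abbrev E (n d : ℕ) := (Fin d → ℝ) × (Fin d → ℝ) × (ℝ × ℝ) ×
  (Fin (n - 1 - d) → ℝ) × (Fin (n - 1 - d) → ℝ)

/-- The Liouville form `λ_V(m)(v) = ⟨p, v_q⟩ + ½(x₀ v_{y₀} − y₀ v_{x₀}) − ⟨y, v_x⟩`. -/
def lambdaV {n d : ℕ} (m v : E n d) : ℝ :=
  (∑ i, m.2.1 i * v.1 i)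
    + (1 / 2) * (m.2.2.1.1 * v.2.2.1.2 - m.2.2.1.2 * v.2.2.1.1)
    - ∑ i, m.2.2.2.2 i * v.2.2.2.1 i

/-- The complex structure
`J_V(v_q, v_p, (v_{x₀}, v_{y₀}), v_x, v_y) = (v_p, −v_q, (−v_{y₀}, v_{x₀}), −v_y, v_x)`. -/
def JV {n d : ℕ} (v : E n d) : E n d :=
  (v.2.1, -v.1, (-v.2.2.1.2, v.2.2.1.1), -v.2.2.2.2, v.2.2.2.1)

/-- The constant symplectic form
`ω(u, v) = ⟨u_p, v_q⟩ − ⟨v_p, u_q⟩ + (u_{x₀} v_{y₀} − v_{x₀} u_{y₀}) + ⟨u_x, v_y⟩ − ⟨v_x, u_y⟩`. -/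
def omegaE {n d : ℕ} (u v : E n d) : ℝ :=
  (∑ i, u.2.1 i * v.1 i) - (∑ i, v.2.1 i * u.1 i)
    + (u.2.2.1.1 * v.2.2.1.2 - v.2.2.1.1 * u.2.2.1.2)
    + (∑ i, u.2.2.2.1 i * v.2.2.2.2 i) - ∑ i, v.2.2.2.1 i * u.2.2.2.2 i

/-- The plurisubharmonic potential `ψ(m) = ½|p|² + ¼(x₀² + y₀²) + ½|y|²`. -/
def psi {n d : ℕ} (m : E n d) : ℝ :=
  (1 / 2) * (∑ i, (m.2.1 i) ^ 2)
    + (1 / 4) * ((m.2.2.1.1) ^ 2 + (m.2.2.1.2) ^ 2)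
    + (1 / 2) * ∑ i, (m.2.2.2.2 i) ^ 2

/-- The Niederkrüger map `Φ(a, b, m) = (a − ψ(m), b, m)` on `ℝ × ℝ × E`. -/
def Phi {n d : ℕ} (w : ℝ × ℝ × E n d) : ℝ × ℝ × E n d :=
  (w.1 - psi w.2.2, w.2.1, w.2.2)

/-- The inverse `(c₁, c₂, m) ↦ (c₁ + ψ(m), c₂, m)` of the Niederkrüger map. -/
def PhiInv {n d : ℕ} (w : ℝ × ℝ × E n d) : ℝ × ℝ × E n d :=
  (w.1 + psi w.2.2, w.2.1, w.2.2)

/-- The differential `DΦ(a, b, m)(v_a, v_b, v) = (v_a − Dψ(m)(v), v_b, v)` of the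
Niederkrüger map (it only depends on the `E`-component `m` of the base point). -/
def DPhi {n d : ℕ} (m : E n d) (w : ℝ × ℝ × E n d) : ℝ × ℝ × E n d :=
  (w.1 - fderiv ℝ psi m w.2.2, w.2.1, w.2.2)

/-- The almost complex structure of the symplectisation:
`Ĵ(m)(v_a, v_b, v) = (−v_b − λ_V(m)(v), v_a − λ_V(m)(J_V v), J_V v)`. -/
def hatJ {n d : ℕ} (m : E n d) (w : ℝ × ℝ × E n d) : ℝ × ℝ × E n d :=
  (-w.2.1 - lambdaV m w.2.2, w.1 - lambdaV m (JV w.2.2), JV w.2.2)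

/-- The target complex structure `(i ⊕ J_V)(w₁, w₂, v) = (−w₂, w₁, J_V v)`. -/
def iJV {n d : ℕ} (w : ℝ × ℝ × E n d) : ℝ × ℝ × E n d :=
  (-w.2.1, w.1, JV w.2.2)

theorem lambdaV_neg {n d : ℕ} (m v : E n d) : lambdaV m (-v) = -lambdaV m v := by
  simp only [lambdaV, Prod.fst_neg, Prod.snd_neg, Pi.neg_apply, mul_neg, Finset.sum_neg_distrib]
  ring

theorem JV_JV {n d : ℕ} (v : E n d) : JV (JV v) = -v := rfl

theorem contDiff_psi {n d : ℕ} : ContDiff ℝ (⊤ : ℕ∞) (psi (n := n) (d := d)) := by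
  unfold psi
  fun_prop

/-- The Liouville form is the twisted differential of the potential: `Dψ = λ_V ∘ J_V`. -/
theorem fderiv_psi {n d : ℕ} (m v : E n d) : fderiv ℝ psi m v = lambdaV m (JV v) := by
  have hψ : DifferentiableAt ℝ (psi (n := n) (d := d)) m :=
    contDiff_psi.differentiable (by simp) m
  have hpath : HasDerivAt (fun t : ℝ => psi (m + t • v)) (fderiv ℝ psi m v) 0 :=
    hψ.hasFDerivAt.hasLineDerivAt v
  have hcoord (a b : ℝ) : HasDerivAt (fun t : ℝ => (a + t * b) ^ 2) (2 * a * b) 0 := by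
    simpa using (((hasDerivAt_id (0 : ℝ)).mul_const b).const_add a).fun_pow 2
  have hsum {k : ℕ} (a b : Fin k → ℝ) :
      HasDerivAt (fun t : ℝ => ∑ i, (a i + t * b i) ^ 2) (∑ i, 2 * a i * b i) 0 :=
    HasDerivAt.fun_sum fun i _ => hcoord (a i) (b i)
  have hcomp := (((hsum m.2.1 v.2.1).const_mul (1 / 2)).add
    (((hcoord m.2.2.1.1 v.2.2.1.1).add (hcoord m.2.2.1.2 v.2.2.1.2)).const_mul (1 / 4))).add
    ((hsum m.2.2.2.2 v.2.2.2.2).const_mul (1 / 2))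
  rw [hpath.unique hcomp]
  simp only [lambdaV, JV, Pi.neg_apply, mul_neg, Finset.sum_neg_distrib, mul_assoc,
    ← Finset.mul_sum]
  ring

theorem fderiv_psi_JV {n d : ℕ} (m v : E n d) : fderiv ℝ psi m (JV v) = -lambdaV m v := by
  rw [fderiv_psi, JV_JV, lambdaV_neg]

theorem contDiff_Phi {n d : ℕ} : ContDiff ℝ (⊤ : ℕ∞) (Phi (n := n) (d := d)) :=
  (contDiff_fst.sub (contDiff_psi.comp (contDiff_snd.comp contDiff_snd))).prodMk contDiff_snd

theorem contDiff_PhiInv {n d : ℕ} : ContDiff ℝ (⊤ : ℕ∞) (PhiInv (n := n) (d := d)) :=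
  (contDiff_fst.add (contDiff_psi.comp (contDiff_snd.comp contDiff_snd))).prodMk contDiff_snd

theorem leftInverse_PhiInv {n d : ℕ} : Function.LeftInverse (PhiInv (n := n) (d := d)) Phi :=
  fun w => by simp [Phi, PhiInv]

theorem rightInverse_PhiInv {n d : ℕ} : Function.RightInverse (PhiInv (n := n) (d := d)) Phi :=
  fun w => by simp [Phi, PhiInv]

theorem fderiv_Phi {n d : ℕ} (w v : ℝ × ℝ × E n d) : fderiv ℝ Phi w v = DPhi w.2.2 v := by
  have hψ : HasFDerivAt (psi (n := n) (d := d)) (fderiv ℝ psi w.2.2) w.2.2 :=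
    (contDiff_psi.differentiable (by simp) w.2.2).hasFDerivAt
  have hΦ : HasFDerivAt (Phi (n := n) (d := d)) _ w :=
    (hasFDerivAt_fst.sub (hψ.comp w (hasFDerivAt_snd.comp w hasFDerivAt_snd))).prodMk
      hasFDerivAt_snd
  rw [hΦ.fderiv]
  rfl

theorem DPhi_hatJ {n d : ℕ} (m : E n d) (w : ℝ × ℝ × E n d) :
    DPhi m (hatJ m w) = iJV (DPhi m w) := by
  simp only [DPhi, hatJ, iJV, fderiv_psi_JV, fderiv_psi m w.2.2, sub_neg_eq_add, sub_add_cancel]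

theorem hatJ_hatJ {n d : ℕ} (m : E n d) (w : ℝ × ℝ × E n d) : hatJ m (hatJ m w) = -w := by
  refine Prod.ext ?_ (Prod.ext ?_ (JV_JV w.2.2))
  · simp [hatJ]
  · simp [hatJ, JV_JV, lambdaV_neg]

/-- The Niederkrüger map `Φ` is a smooth bijection with smooth inverse, its differential at
`(a, b, m)` is `(v_a, v_b, v) ↦ (v_a − Dψ(m)(v), v_b, v)` and intertwines `Ĵ(m)` with
`i ⊕ J_V`; moreover `Ĵ(m) ∘ Ĵ(m) = −id`. -/
theorem niederkrueger_biholomorphic (n d : ℕ) (h : d < n) :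
    ContDiff ℝ (⊤ : ℕ∞) (Phi (n := n) (d := d)) ∧
    ContDiff ℝ (⊤ : ℕ∞) (PhiInv (n := n) (d := d)) ∧
    Function.LeftInverse (PhiInv (n := n) (d := d)) Phi ∧
    Function.RightInverse (PhiInv (n := n) (d := d)) Phi ∧
    Function.Bijective (Phi (n := n) (d := d)) ∧
    (∀ w v : ℝ × ℝ × E n d, fderiv ℝ Phi w v = DPhi w.2.2 v) ∧
    (∀ (m : E n d) (w : ℝ × ℝ × E n d), DPhi m (hatJ m w) = iJV (DPhi m w)) ∧
    (∀ (m : E n d) (w : ℝ × ℝ × E n d), hatJ m (hatJ m w) = -w) := by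
  exact ⟨contDiff_Phi, contDiff_PhiInv, leftInverse_PhiInv, rightInverse_PhiInv,
    ⟨leftInverse_PhiInv.injective, rightInverse_PhiInv.surjective⟩,
    fderiv_Phi, DPhi_hatJ, hatJ_hatJ⟩
end
end

section
/- Boundary immersivity and positive transversality (Hopf boundary lemma for proper holomorphic discs): let f : ℂ → ℂ be complex differentiable on an open set U containing the closed unit disc, with |f(z)| < 1 for all |z| < 1 and |f(z)| = 1 for all |z| = 1. Then for every z with |z| = 1 the complex number z · f′(z) / f(z) is a positive real number; in particular f′(z) ≠ 0 for all |z| = 1, so the boundary restriction θ ↦ f(e^{iθ}) is an immersion winding positively around the origin. -/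
open Complex ComplexConjugate Filter Topology

/-- The identity behind the pseudo-hyperbolic metric of the unit disc. -/
theorem normSq_one_sub_conj_mul_sub_normSq_sub (a b : ℂ) :
    ‖1 - conj a * b‖ ^ 2 - ‖b - a‖ ^ 2 = (1 - ‖a‖ ^ 2) * (1 - ‖b‖ ^ 2) := by
  simp only [← Complex.normSq_eq_norm_sq, Complex.normSq_apply, Complex.sub_re, Complex.sub_im,
    Complex.mul_re, Complex.mul_im, Complex.conj_re, Complex.conj_im, Complex.one_re,
    Complex.one_im]
  ring

/-- A form of the Schwarz–Pick inequality: for a holomorphic self-map of the unit disc,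
`1 - |f w|²` is bounded below by a positive multiple of `1 - |w|²`. -/
theorem exists_pos_mul_one_sub_normSq_le {f : ℂ → ℂ}
    (hf : DifferentiableOn ℂ f (Metric.ball 0 1)) (h1 : ∀ z : ℂ, ‖z‖ < 1 → ‖f z‖ < 1) :
    ∃ c : ℝ, 0 < c ∧ ∀ w : ℂ, ‖w‖ < 1 → c * (1 - ‖w‖ ^ 2) ≤ 1 - ‖f w‖ ^ 2 := by
  set a := f 0 with ha
  have ha1 : ‖a‖ < 1 := h1 0 (by simp)
  have ha0 : 0 ≤ ‖a‖ := norm_nonneg a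
  have hden : ∀ w : ℂ, ‖w‖ < 1 → 1 - ‖a‖ ≤ ‖1 - conj a * f w‖ := fun w hw => by
    have h : ‖(1 : ℂ)‖ - ‖conj a * f w‖ ≤ ‖1 - conj a * f w‖ := norm_sub_norm_le _ _
    rw [norm_mul, Complex.norm_conj, norm_one] at h
    nlinarith [h1 w hw]
  have hden0 : ∀ w : ℂ, ‖w‖ < 1 → 0 < ‖1 - conj a * f w‖ := fun w hw => by
    linarith [hden w hw]
  have hpos : 0 < 1 - ‖a‖ ^ 2 := by nlinarith
  have hschwarz : ∀ w : ℂ, ‖w‖ < 1 → ‖f w - a‖ ≤ ‖w‖ * ‖1 - conj a * f w‖ := fun w hw => by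
    have h := Complex.norm_le_norm_of_mapsTo_ball (R := 1) (z := w)
      (f := fun z => (f z - a) / (1 - conj a * f z)) ?_ ?_ (by simp [ha]) hw
    · rwa [norm_div, div_le_iff₀ (hden0 w hw)] at h
    · exact (hf.sub_const a).div ((hf.const_mul (conj a)).const_sub 1) fun z hz =>
        norm_pos_iff.1 (hden0 z (by simpa using hz))
    · intro z hz
      have hz' : ‖z‖ < 1 := by simpa using hz
      rw [mem_closedBall_zero_iff, norm_div, div_le_one (hden0 z hz')]
      refine le_of_sq_le_sq ?_ (norm_nonneg _)
      have hfz : 0 ≤ 1 - ‖f z‖ ^ 2 := by nlinarith [h1 z hz', norm_nonneg (f z)]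
      nlinarith [normSq_one_sub_conj_mul_sub_normSq_sub a (f z), mul_nonneg hpos.le hfz]
  refine ⟨(1 - ‖a‖) ^ 2 / (1 - ‖a‖ ^ 2), div_pos (by nlinarith) hpos, fun w hw => ?_⟩
  rw [div_mul_eq_mul_div, div_le_iff₀ hpos]
  have hw2 : 0 ≤ 1 - ‖w‖ ^ 2 := by nlinarith [norm_nonneg w]
  have hs := pow_le_pow_left₀ (norm_nonneg _) (hschwarz w hw) 2
  have hd := pow_le_pow_left₀ (by linarith) (hden w hw) 2
  rw [mul_pow] at hs
  nlinarith [normSq_one_sub_conj_mul_sub_normSq_sub a (f w), mul_le_mul_of_nonneg_right hd hw2]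

/-- The derivative of `|f|²` along the curve `t ↦ z * exp (t * v)` at a point with `|f z| = 1`. -/
theorem hasDerivAt_normSq_mul_exp {f : ℂ → ℂ} {z : ℂ} (hf : DifferentiableAt ℂ f z)
    (hfz : ‖f z‖ = 1) (v : ℂ) :
    HasDerivAt (fun t : ℝ => ‖f (z * exp (t * v))‖ ^ 2) (2 * (v * (z * deriv f z / f z)).re) 0 := by
  have hcurve : HasDerivAt (fun t : ℂ => z * exp (t * v)) (z * v) 0 := by
    simpa using (((hasDerivAt_id (0 : ℂ)).mul_const v).cexp).const_mul z
  have hcomp : HasDerivAt (fun t : ℂ => f (z * exp (t * v))) (deriv f z * (z * v)) ((0 : ℝ) : ℂ) :=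
    HasDerivAt.comp_of_eq ((0 : ℝ) : ℂ) hf.hasDerivAt (by simpa using hcurve) (by simp)
  convert hcomp.comp_ofReal.norm_sq using 1
  have hinv : (f z)⁻¹ = conj (f z) := by
    rw [Complex.inv_def, Complex.normSq_eq_norm_sq, hfz]; simp
  simp only [Complex.inner, Complex.ofReal_zero, zero_mul, Complex.exp_zero, mul_one,
    div_eq_mul_inv, hinv]
  congr 2
  ring

/-- A function nonnegative to the left of a zero has nonpositive derivative there. -/
theorem HasDerivAt.nonpos_of_nonneg_left {g : ℝ → ℝ} {g' x : ℝ} (hg : HasDerivAt g g' x)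
    (hx : g x = 0) (h : ∀ t < x, 0 ≤ g t) : g' ≤ 0 := by
  refine le_of_tendsto (hasDerivAt_iff_tendsto_slope_left_right.1 hg).1 ?_
  filter_upwards [self_mem_nhdsWithin] with t ht
  rw [slope_def_field, hx, sub_zero]
  exact div_nonpos_of_nonneg_of_nonpos (h t ht) (sub_nonpos.2 (le_of_lt ht))

/-- Boundary immersivity and positive transversality (Hopf boundary lemma for proper
holomorphic discs): if `f` is holomorphic on an open set containing the closed unit disc,
with `|f| < 1` on the open disc and `|f| = 1` on the unit circle, then for every `z` on the
unit circle the number `z·f′(z)/f(z)` is a positive real number; in particular `f′(z) ≠ 0`. -/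
theorem hopf_boundary_positivity (U : Set ℂ) (hU : IsOpen U)
    (hsub : {z : ℂ | ‖z‖ ≤ 1} ⊆ U) (f : ℂ → ℂ) (hf : DifferentiableOn ℂ f U)
    (h1 : ∀ z : ℂ, ‖z‖ < 1 → ‖f z‖ < 1) (h2 : ∀ z : ℂ, ‖z‖ = 1 → ‖f z‖ = 1) :
    ∀ z : ℂ, ‖z‖ = 1 →
      deriv f z ≠ 0 ∧ (z * deriv f z / f z).im = 0 ∧ 0 < (z * deriv f z / f z).re := by
  intro z hz
  have hfz := h2 z hz
  have hd : DifferentiableAt ℂ f z := hf.differentiableAt (hU.mem_nhds (hsub hz.le))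
  obtain ⟨c, hc, hle⟩ := exists_pos_mul_one_sub_normSq_le
    (hf.mono fun w hw => hsub (le_of_lt (by simpa using hw))) h1
  have him : (z * deriv f z / f z).im = 0 := by
    have hconst : (fun t : ℝ => ‖f (z * exp (t * I))‖ ^ 2) = fun _ => 1 := by
      funext t
      rw [h2 _ (by rw [norm_mul, hz, Complex.norm_exp_ofReal_mul_I, one_mul]), one_pow]
    have h := hasDerivAt_normSq_mul_exp hd hfz I
    rw [hconst] at h
    have h0 := h.unique (hasDerivAt_const (0 : ℝ) (1 : ℝ))
    rw [Complex.I_mul_re] at h0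
    linarith
  have hre : 0 < (z * deriv f z / f z).re := by
    have hexp : HasDerivAt (fun t : ℝ => Real.exp t ^ 2) 2 0 := by
      simpa using (Real.hasDerivAt_exp 0).fun_pow 2
    have h := ((hasDerivAt_normSq_mul_exp hd hfz 1).const_sub 1).sub
      ((hexp.const_sub 1).const_mul c)
    have h0 := h.nonpos_of_nonneg_left (by simp [hfz]) fun t ht => by
      have hnorm : ‖z * exp (t * 1)‖ = Real.exp t := by
        rw [norm_mul, hz, mul_one, Complex.norm_exp_ofReal, one_mul]
      have := hle (z * exp (t * 1)) (by rw [hnorm]; exact Real.exp_lt_one_iff.2 ht)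
      rw [hnorm] at this
      exact sub_nonneg.2 this
    rw [one_mul] at h0
    linarith
  exact ⟨fun h => by simp [h] at hre, him, hre⟩
end

section
/- The interpolating Liouville vector field Y = Y₀ + X_H is transverse to all spheres of radius at least 1: for χ̃ : ℝ → ℝ smooth with 0 ≤ χ̃ ≤ 1/4, the derivative of ρ² at m in the direction Y(m) equals 2|p|² + |x|² + |y|² + 2χ̃(ρ²(m))·x₁, and this quantity is strictly positive at every point m with ρ²(m) ≥ 1. -/
noncomputable section

/-- The model space `F = ℝ^d × ℝ^d × ℝ^{m₀} × ℝ^{m₀}` with `m₀ = n + 1 − d`,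
with components `(q, p, x, y)`. -/
abbrev F (n d : ℕ) := (Fin d → ℝ) × (Fin d → ℝ) × (Fin (n - d + 1) → ℝ) ×
  (Fin (n - d + 1) → ℝ)

/-- The Liouville form `λ(m)(v) = ⟨p, v_q⟩ + ½(⟨x, v_y⟩ − ⟨y, v_x⟩)`. -/
def lambdaF {n d : ℕ} (m v : F n d) : ℝ :=
  (∑ i, m.2.1 i * v.1 i)
    + (1 / 2) * ((∑ i, m.2.2.1 i * v.2.2.2 i) - ∑ i, m.2.2.2 i * v.2.2.1 i)

/-- The constant symplectic form
`ω(u, v) = ⟨u_p, v_q⟩ − ⟨v_p, u_q⟩ + ⟨u_x, v_y⟩ − ⟨v_x, u_y⟩`. -/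
def omegaF {n d : ℕ} (u v : F n d) : ℝ :=
  (∑ i, u.2.1 i * v.1 i) - (∑ i, v.2.1 i * u.1 i)
    + (∑ i, u.2.2.1 i * v.2.2.2 i) - ∑ i, v.2.2.1 i * u.2.2.2 i

/-- The Liouville vector field `Y₀(m) = (0, p, x/2, y/2)`. -/
def Y0 {n d : ℕ} (m : F n d) : F n d :=
  (0, m.2.1, fun i => m.2.2.1 i / 2, fun i => m.2.2.2 i / 2)

/-- The distance function `ρ²(m) = |p|² + |x|² + |y|²`. -/
def rhoSq {n d : ℕ} (m : F n d) : ℝ :=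
  (∑ i, (m.2.1 i) ^ 2) + (∑ i, (m.2.2.1 i) ^ 2) + ∑ i, (m.2.2.2 i) ^ 2

/-- The first standard basis vector `e₁` of `ℝ^{m₀}`. -/
def e1 {k : ℕ} : Fin (k + 1) → ℝ := fun i => if i = 0 then 1 else 0

/-- The Hamiltonian vector field
`X_H(m) = (−2χ̃′(ρ²) y₁ p, 0, 2χ̃′(ρ²) y₁ y + χ̃(ρ²) e₁, −2χ̃′(ρ²) y₁ x)`. -/
def XH {n d : ℕ} (χ : ℝ → ℝ) (m : F n d) : F n d :=
  (fun i => -(2 * deriv χ (rhoSq m) * m.2.2.2 0 * m.2.1 i), 0,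
   fun i => 2 * deriv χ (rhoSq m) * m.2.2.2 0 * m.2.2.2 i + χ (rhoSq m) * e1 i,
   fun i => -(2 * deriv χ (rhoSq m) * m.2.2.2 0 * m.2.2.1 i))

/-- The interpolating Liouville vector field `Y = Y₀ + X_H`. -/
def Yfield {n d : ℕ} (χ : ℝ → ℝ) (m : F n d) : F n d := Y0 m + XH χ m

/-- The derivative of a sum of squares of continuous linear functionals. -/
theorem hasFDerivAt_sum_sq_clm {E ι : Type*} [NormedAddCommGroup E] [NormedSpace ℝ E] [Fintype ι]
    (L : ι → E →L[ℝ] ℝ) (m : E) :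
    HasFDerivAt (fun m => ∑ i, (L i m) ^ 2) (∑ i, (2 * L i m) • L i) m := by
  refine HasFDerivAt.fun_sum fun i _ => ?_
  simpa using (L i).hasFDerivAt.pow 2

/-- The directional derivative of `ρ²` is twice the inner product of the `(p, x, y)`-parts. -/
theorem fderiv_rhoSq_apply {n d : ℕ} (m v : F n d) :
    fderiv ℝ rhoSq m v = (∑ i, 2 * m.2.1 i * v.2.1 i) + (∑ i, 2 * m.2.2.1 i * v.2.2.1 i)
      + ∑ i, 2 * m.2.2.2 i * v.2.2.2 i := by
  let s : F n d →L[ℝ] _ := ContinuousLinearMap.snd ℝ _ _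
  let t : F n d →L[ℝ] _ := (ContinuousLinearMap.snd ℝ _ _).comp s
  have hp := hasFDerivAt_sum_sq_clm (fun i => (ContinuousLinearMap.proj (R := ℝ) i).comp
    ((ContinuousLinearMap.fst ℝ (Fin d → ℝ) _).comp s)) m
  have hx := hasFDerivAt_sum_sq_clm (fun i => (ContinuousLinearMap.proj (R := ℝ) i).comp
    ((ContinuousLinearMap.fst ℝ (Fin (n - d + 1) → ℝ) _).comp t)) m
  have hy := hasFDerivAt_sum_sq_clm (fun i => (ContinuousLinearMap.proj (R := ℝ) i).comp
    ((ContinuousLinearMap.snd ℝ _ (Fin (n - d + 1) → ℝ)).comp t)) m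
  have hρ : HasFDerivAt (rhoSq (n := n) (d := d)) _ m := (hp.add hx).add hy
  rw [hρ.fderiv]
  simp [s, t]

/-- The interpolating Liouville vector field `Y = Y₀ + X_H` is transverse to all spheres of
radius at least `1`: for smooth `χ̃` with `0 ≤ χ̃ ≤ 1/4`, the derivative of `ρ²` in the
direction `Y(m)` equals `2|p|² + |x|² + |y|² + 2χ̃(ρ²(m))·x₁`, which is strictly positive
whenever `ρ²(m) ≥ 1`. -/
theorem Yfield_transverse_to_spheres (n d : ℕ) (h : d < n) (χ : ℝ → ℝ)
    (hχ : ContDiff ℝ (⊤ : ℕ∞) χ) (h0 : ∀ s, 0 ≤ χ s) (h14 : ∀ s, χ s ≤ 1 / 4) :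
    (∀ m : F n d, fderiv ℝ rhoSq m (Yfield χ m) =
      2 * (∑ i, (m.2.1 i) ^ 2) + (∑ i, (m.2.2.1 i) ^ 2) + (∑ i, (m.2.2.2 i) ^ 2)
        + 2 * χ (rhoSq m) * m.2.2.1 0) ∧
    (∀ m : F n d, 1 ≤ rhoSq m →
      0 < 2 * (∑ i, (m.2.1 i) ^ 2) + (∑ i, (m.2.2.1 i) ^ 2) + (∑ i, (m.2.2.2 i) ^ 2)
        + 2 * χ (rhoSq m) * m.2.2.1 0) := by
  refine ⟨fun m => ?_, fun m hm => ?_⟩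
  · have hx₁ : m.2.2.1 0 = ∑ i, m.2.2.1 i * e1 i := by simp [e1]
    rw [fderiv_rhoSq_apply, hx₁]
    simp only [Yfield, Y0, XH, Prod.snd_add, Prod.fst_add, Pi.add_apply, Pi.zero_apply,
      add_zero, Finset.mul_sum]
    rw [add_assoc, ← Finset.sum_add_distrib, add_assoc, add_assoc, ← Finset.sum_add_distrib,
      ← Finset.sum_add_distrib]
    congr 1 <;> exact Finset.sum_congr rfl fun i _ => by ring
  · have hp : 0 ≤ ∑ i, (m.2.1 i) ^ 2 := Finset.sum_nonneg fun i _ => sq_nonneg _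
    have hy : 0 ≤ ∑ i, (m.2.2.2 i) ^ 2 := Finset.sum_nonneg fun i _ => sq_nonneg _
    have hx : (m.2.2.1 0) ^ 2 ≤ ∑ i, (m.2.2.1 i) ^ 2 :=
      Finset.single_le_sum (f := fun i => (m.2.2.1 i) ^ 2) (fun i _ => sq_nonneg _)
        (Finset.mem_univ 0)
    have hχx : -(|m.2.2.1 0| / 2) ≤ 2 * χ (rhoSq m) * m.2.2.1 0 := by
      nlinarith [neg_abs_le (m.2.2.1 0), abs_nonneg (m.2.2.1 0), h0 (rhoSq m), h14 (rhoSq m)]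
    rw [rhoSq] at hm
    nlinarith [sq_nonneg (|m.2.2.1 0| - 1 / 2), sq_abs (m.2.2.1 0)]
end
end
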